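/- Let $\mathcal V,\mathcal X,\mathcal Y$ be finite alphabets, $P_V$ a probability distribution on $\mathcal V$, $W(y|x)$ a stochastic matrix from $\mathcal X$ to $\mathcal Y$, $t>0$, and $\mathcal Q_m=\{Q_1,\dots,Q_m\}$ ($m\ge 1$) a finite set of probability distributions on $\mathcal X$. Logarithms are natural, all quantities take values in $[-\infty,+\infty]$, and the conventions $\log 0=-\infty$, $0\cdot(\pm\infty)=0$, $e^{-\infty}=0$, $\min\emptyset=+\infty$ are used. Let $H(Q)=-\sum_v Q(v)\log Q(v)$, let $D(Q\|P)=\sum_v Q(v)\log\frac{Q(v)}{P(v)}$ (equal to $+\infty$ unless $Q\ll P$), and put $$e(R,P_V)=\min_{Q:\,H(Q)\ge R}D(Q\|P_V),\qquad E_s(\rho,P_V)=(1+\rho)\log\sum_{v}P_V(v)^{1/(1+\rho)},$$ $$d_B(x,\bar x)=-\log\sum_y\sqrt{W(y|x)W(y|\bar x)},$$ $$E'_{\mathrm{ex}}(Q,R)=\min_{\substack{P_{X\bar X}:\,P_X=Q\\ I_P(X;\bar X)\le R}}\Big\{\mathbb E_P[d_B(X,\bar X)]+I_P(X;\bar X)-R\Big\},$$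 $$E'_{\mathrm x}(Q,\rho)=\min_{Q'}\Big\{-\rho\sum_xQ(x)\log\sum_{\bar x}Q'(\bar x)e^{-d_B(x,\bar x)/\rho}\Big\},$$ where $P_{X\bar X}$ ranges over probability distributions on $\mathcal X\times\mathcal X$ with mutual information $I_P(X;\bar X)$, and $Q'$ over probability distributions on $\mathcal X$. Let $$\overline E'_{\mathrm x}(\mathcal Q_m,\lambda)=\inf_{R\ge0}\ \sup_{\rho\ge1}\Big[\max_{Q\in\mathcal Q_m}E'_{\mathrm x}(Q,\rho)+(\lambda-\rho)R\Big].$$ Then the primal and dual exponents coincide: the minimum on the left-hand side below is attained, and $$\min_{R\ge0}\Big[t\,e\Big(\frac Rt,P_V\Big)+\max_{Q\in\mathcal Q_m}E'_{\mathrm{ex}}(Q,R)\Big]=\sup_{\lambda\ge1}\Big\{\overline E'_{\mathrm x}(\mathcal Q_m,\lambda)-t\,E_s(\lambda,P_V)\Big\}.$$ Both sides may equal $+\infty$. -/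

import Mathlib

open scoped BigOperators

noncomputable section

/-! Probability distributions on a finite alphabet `α` are the elements of `stdSimplex ℝ α`.
Exponents are extended reals, with the usual conventions `log 0 = -∞`, `0 · (±∞) = 0` and
`min ∅ = +∞`. -/

/-- `W` is a stochastic matrix: `W x y` stands for `W(y|x)`. -/
def IsStochastic {X Y : Type*} [Fintype Y] (W : X → Y → ℝ) : Prop :=
  ∀ x, W x ∈ stdSimplex ℝ Y

/-- Shannon entropy `H(P) = -∑ P log P`. -/
def entropy {α : Type*} [Fintype α] (P : α → ℝ) : ℝ := -∑ a, P a * Real.log (P a)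

open Classical in
/-- Relative entropy `D(Q‖P) = ∑ Q log (Q / P)`, equal to `+∞` unless `Q ≪ P`. -/
def relEntropy {α : Type*} [Fintype α] (Q P : α → ℝ) : EReal :=
  if ∀ a, P a = 0 → Q a = 0 then ((∑ a, Q a * Real.log (Q a / P a) : ℝ) : EReal) else ⊤

/-- Source reliability function `e(R, P_V) = min_{Q : H(Q) ≥ R} D(Q‖P_V)`
(`+∞` if no distribution has entropy at least `R`). -/
def srcRel {V : Type*} [Fintype V] (PV : V → ℝ) (R : ℝ) : EReal :=
  ⨅ (Q ∈ stdSimplex ℝ V) (_ : R ≤ entropy Q), relEntropy Q PV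

/-- `E_s(ρ, P_V) = (1 + ρ) log ∑ P_V(v)^(1/(1+ρ))`. -/
def Es {V : Type*} [Fintype V] (PV : V → ℝ) (ρ : ℝ) : ℝ :=
  (1 + ρ) * Real.log (∑ v, PV v ^ (1 / (1 + ρ)))

/-- Bhattacharyya distance `d_B(x, x̄) = -log ∑_y √(W(y|x) W(y|x̄))`, equal to `+∞` when the
sum vanishes (`ENNReal.log 0 = ⊥`). -/
def dB {X Y : Type*} [Fintype Y] (W : X → Y → ℝ) (x x' : X) : EReal :=
  -ENNReal.log (ENNReal.ofReal (∑ y, √(W x y * W x' y)))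

/-- Mutual information `I_P(X; X̄)` of a joint distribution on `X × X`. -/
def mutualInfo {X : Type*} [Fintype X] (P : X × X → ℝ) : ℝ :=
  ∑ p : X × X, P p * Real.log (P p / ((∑ x', P (p.1, x')) * (∑ x, P (x, p.2))))

/-- Weak expurgated exponent: the minimum of `𝔼_P[d_B(X, X̄)] + I_P(X; X̄) - R` over the joint
distributions `P` with first marginal `Q` and `I_P(X; X̄) ≤ R`. -/
def EexWeak {X Y : Type*} [Fintype X] [Fintype Y] (W : X → Y → ℝ) (Q : X → ℝ) (R : ℝ) : EReal :=
  ⨅ (P ∈ stdSimplex ℝ (X × X)) (_ : ∀ x, ∑ x', P (x, x') = Q x) (_ : mutualInfo P ≤ R),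
    (∑ p : X × X, (P p : EReal) * dB W p.1 p.2) + (mutualInfo P : EReal) - (R : EReal)

/-- Dual weak expurgated function
`E'_x(Q, ρ) = min_{Q'} -ρ ∑_x Q(x) log ∑_x̄ Q'(x̄) exp(-d_B(x, x̄)/ρ)`. -/
def ExWeak {X Y : Type*} [Fintype X] [Fintype Y] (W : X → Y → ℝ) (Q : X → ℝ) (ρ : ℝ) : EReal :=
  ⨅ Q' ∈ stdSimplex ℝ X,
    -((ρ : EReal) * ∑ x, (Q x : EReal) *
      ENNReal.log (∑ x', ENNReal.ofReal (Q' x') * EReal.exp (-(dB W x x' / (ρ : EReal)))))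

/-- `Ē'_x(𝒬ₘ, λ) = inf_{R ≥ 0} sup_{ρ ≥ 1} [max_{Q ∈ 𝒬ₘ} E'_x(Q, ρ) + (λ - ρ) R]`. -/
def ExBar {X Y : Type*} [Fintype X] [Fintype Y] (W : X → Y → ℝ) {m : ℕ}
    (Qs : Fin m → X → ℝ) (lam : ℝ) : EReal :=
  ⨅ (R : ℝ) (_ : 0 ≤ R), ⨆ (ρ : ℝ) (_ : 1 ≤ ρ),
    (⨆ c, ExWeak W (Qs c) ρ) + (((lam - ρ) * R : ℝ) : EReal)

/-- Objective of the primal problem: `t e(R/t, P_V) + max_{Q ∈ 𝒬ₘ} E'_ex(Q, R)`. -/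
def primalObj {V X Y : Type*} [Fintype V] [Fintype X] [Fintype Y]
    (PV : V → ℝ) (W : X → Y → ℝ) (t : ℝ) {m : ℕ} (Qs : Fin m → X → ℝ) (R : ℝ) : EReal :=
  (t : EReal) * srcRel PV (R / t) + ⨆ c, EexWeak W (Qs c) R

/-- Dual exponent: `sup_{λ ≥ 1} {Ē'_x(𝒬ₘ, λ) - t E_s(λ, P_V)}`. -/
def dualExponent {V X Y : Type*} [Fintype V] [Fintype X] [Fintype Y]
    (PV : V → ℝ) (W : X → Y → ℝ) (t : ℝ) {m : ℕ} (Qs : Fin m → X → ℝ) : EReal :=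
  ⨆ (lam : ℝ) (_ : 1 ≤ lam), ExBar W Qs lam - ((t * Es PV lam : ℝ) : EReal)

end

/-! ### A Lagrange duality principle on compact convex sets -/

open scoped Pointwise in
/-- Strong Lagrange duality with one constraint: if every Lagrangian `f + s g`, `s ≥ 0`, takes
values below any number larger than `c` on the compact convex set `K`, then some point of `K`
satisfies the constraint `g ≤ 0` and has `f ≤ c`. -/
theorem exists_le_of_lagrangian_lt {E : Type*} [AddCommGroup E] [Module ℝ E] [TopologicalSpace E]
    {K : Set E} (hK : IsCompact K) {f g : E → ℝ} (hf : ConvexOn ℝ K f) (hg : ConvexOn ℝ K g)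
    (hfc : ContinuousOn f K) (hgc : ContinuousOn g K) {c : ℝ}
    (h : ∀ s : ℝ, 0 ≤ s → ∀ c' : ℝ, c < c' → ∃ x ∈ K, f x + s * g x < c') :
    ∃ x ∈ K, g x ≤ 0 ∧ f x ≤ c := by
  by_contra hne
  push Not at hne
  set A : Set (ℝ × ℝ) := (fun x => (f x, g x)) '' K + Set.Ici (0 : ℝ × ℝ) with hA
  have hAmem : ∀ x ∈ K, ∀ u v : ℝ, f x ≤ u → g x ≤ v → (u, v) ∈ A := by
    intro x hx u v hu hv
    refine ⟨(f x, g x), ⟨x, hx, rfl⟩, (u - f x, v - g x), ?_, by ext <;> simp⟩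
    exact ⟨by simpa using hu, by simpa using hv⟩
  have hAmem' : ∀ p ∈ A, ∃ x ∈ K, f x ≤ p.1 ∧ g x ≤ p.2 := by
    rintro p ⟨_, ⟨x, hx, rfl⟩, q, hq, rfl⟩
    have hq' : (0 : ℝ × ℝ) ≤ q := hq
    exact ⟨x, hx, by simpa using hq'.1, by simpa using hq'.2⟩
  have hclosed : IsClosed A :=
    isClosed_Ici.add_left_of_isCompact (hK.image_of_continuousOn (hfc.prodMk hgc))
  have hconv : Convex ℝ A := by
    rintro p hp q hq a b ha hb hab
    obtain ⟨x, hx, hx1, hx2⟩ := hAmem' p hp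
    obtain ⟨y, hy, hy1, hy2⟩ := hAmem' q hq
    refine hAmem _ (hf.1 hx hy ha hb hab) _ _ ?_ ?_
    · refine (hf.2 hx hy ha hb hab).trans ?_
      simp only [smul_eq_mul, Prod.smul_fst]
      gcongr
    · refine (hg.2 hx hy ha hb hab).trans ?_
      simp only [smul_eq_mul, Prod.smul_snd]
      gcongr
  have hnot : (c, (0 : ℝ)) ∉ A := by
    intro hmem
    obtain ⟨x, hx, h1, h2⟩ := hAmem' _ hmem
    exact absurd h1 (not_le.2 (hne x hx h2))
  obtain ⟨φ, u, hφ, hu⟩ := geometric_hahn_banach_point_closed hconv hclosed hnot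
  set a := φ (1, 0) with ha
  set b := φ (0, 1) with hb
  have hφe : ∀ p q : ℝ, φ (p, q) = p * a + q * b := by
    intro p q
    have : ((p, q) : ℝ × ℝ) = p • (1, 0) + q • (0, 1) := by ext <;> simp
    rw [this, map_add, map_smul, map_smul, smul_eq_mul, smul_eq_mul]
  obtain ⟨x₀, hx₀, -⟩ := h 0 le_rfl (c + 1) (by linarith)
  have hgap : ∀ p q : ℝ, f x₀ ≤ p → g x₀ ≤ q → u < p * a + q * b := by
    intro p q hp hq
    rw [← hφe]
    exact hu _ (hAmem x₀ hx₀ p q hp hq)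
  rw [hφe] at hφ
  have ha0 : 0 ≤ a := by
    by_contra hlt
    push Not at hlt
    have hn : 0 ≤ |u - (f x₀ * a + g x₀ * b)| / (-a) := by
      have : 0 < -a := by linarith
      positivity
    have h1 := hgap (f x₀ + |u - (f x₀ * a + g x₀ * b)| / (-a)) (g x₀) (by linarith) le_rfl
    have h2 : |u - (f x₀ * a + g x₀ * b)| / (-a) * a = -|u - (f x₀ * a + g x₀ * b)| := by
      rw [div_neg, neg_mul, div_mul_cancel₀ _ hlt.ne]
    have h3 := neg_abs_le (u - (f x₀ * a + g x₀ * b))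
    nlinarith
  have hb0 : 0 ≤ b := by
    by_contra hlt
    push Not at hlt
    have hn : 0 ≤ |u - (f x₀ * a + g x₀ * b)| / (-b) := by
      have : 0 < -b := by linarith
      positivity
    have h1 := hgap (f x₀) (g x₀ + |u - (f x₀ * a + g x₀ * b)| / (-b)) le_rfl (by linarith)
    have h2 : |u - (f x₀ * a + g x₀ * b)| / (-b) * b = -|u - (f x₀ * a + g x₀ * b)| := by
      rw [div_neg, neg_mul, div_mul_cancel₀ _ hlt.ne]
    have h3 := neg_abs_le (u - (f x₀ * a + g x₀ * b))
    nlinarith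
  have hK' : ∀ x ∈ K, u < f x * a + g x * b := fun x hx => by
    rw [← hφe]
    exact hu _ (hAmem x hx _ _ le_rfl le_rfl)
  rcases ha0.eq_or_lt with ha1 | ha1
  · rw [← ha1] at hφ hK'
    simp only [mul_zero, zero_mul, add_zero, zero_add] at hφ hK'
    obtain ⟨y, -, hy⟩ := hK.exists_isMinOn ⟨x₀, hx₀⟩ hfc
    obtain ⟨x, hx, hlt⟩ := h (max 0 ((c + 1 - f y) * b / u)) (le_max_left _ _) (c + 1)
      (by linarith)
    have hyx : f y ≤ f x := hy hx
    have hgx := hK' x hx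
    have hbpos : 0 < b := by
      rcases hb0.eq_or_lt with h0 | h0
      · rw [← h0] at hgx
        simp at hgx
        linarith
      · exact h0
    have hgu : u / b < g x := by rwa [div_lt_iff₀ hbpos]
    have hub : 0 < u / b := by positivity
    have h1 : (c + 1 - f y) * b / u * (u / b) = c + 1 - f y := by field_simp
    have h2 := le_max_right 0 ((c + 1 - f y) * b / u)
    have h3 := le_max_left 0 ((c + 1 - f y) * b / u)
    nlinarith [mul_le_mul_of_nonneg_right h2 hub.le, mul_le_mul_of_nonneg_left hgu.le h3]
  · obtain ⟨x, hx, hlt⟩ := h (b / a) (by positivity) (u / a) (by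
      rw [lt_div_iff₀ ha1]
      linarith)
    have h1 := hK' x hx
    rw [lt_div_iff₀ ha1] at hlt
    have h2 : (f x + b / a * g x) * a = f x * a + g x * b := by
      field_simp
    linarith

/-! ### The log-sum inequality -/

/-- Tangent-line bound for the perspective `a log (a / b)` at slope `r`. -/
theorem mul_log_add_sub_le {a b r : ℝ} (ha : 0 ≤ a) (hb : 0 ≤ b) (hab : b = 0 → a = 0)
    (hr : 0 < r) : a * Real.log r + a - b * r ≤ a * Real.log (a / b) := by
  rcases ha.eq_or_lt with rfl | ha
  · simp only [zero_mul, zero_add, zero_sub]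
    nlinarith
  have hb' : 0 < b := lt_of_le_of_ne hb fun h => ha.ne' (hab h.symm)
  have h1 := Real.log_le_sub_one_of_pos (show 0 < b * r / a by positivity)
  rw [Real.log_div (by positivity) ha.ne', Real.log_mul hb'.ne' hr.ne'] at h1
  rw [Real.log_div ha.ne' hb'.ne']
  have h2 : a * (b * r / a - 1) = b * r - a := by field_simp
  nlinarith [mul_le_mul_of_nonneg_left h1 ha.le]

/-- The log-sum inequality. -/
theorem log_sum_inequality {ι : Type*} (s : Finset ι) {a b : ι → ℝ} (ha : ∀ i ∈ s, 0 ≤ a i)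
    (hb : ∀ i ∈ s, 0 ≤ b i) (hab : ∀ i ∈ s, b i = 0 → a i = 0) :
    (∑ i ∈ s, a i) * Real.log ((∑ i ∈ s, a i) / ∑ i ∈ s, b i) ≤
      ∑ i ∈ s, a i * Real.log (a i / b i) := by
  rcases (Finset.sum_nonneg ha).eq_or_lt with hA | hA
  · rw [← hA, zero_mul]
    refine (Finset.sum_eq_zero fun i hi => ?_).ge
    rw [(Finset.sum_eq_zero_iff_of_nonneg ha).1 hA.symm i hi, zero_mul]
  have hB : 0 < ∑ i ∈ s, b i := by
    refine lt_of_le_of_ne (Finset.sum_nonneg hb) fun h0 => hA.ne' ?_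
    exact Finset.sum_eq_zero fun i hi =>
      hab i hi ((Finset.sum_eq_zero_iff_of_nonneg hb).1 h0.symm i hi)
  have key := Finset.sum_le_sum fun i hi =>
    mul_log_add_sub_le (ha i hi) (hb i hi) (hab i hi) (div_pos hA hB)
  rw [Finset.sum_sub_distrib, Finset.sum_add_distrib, ← Finset.sum_mul, ← Finset.sum_mul,
    mul_div_cancel₀ _ hB.ne'] at key
  linarith

/-- Joint convexity of `(a, b) ↦ a log (a / b)`. -/
theorem mul_log_div_convex {a₁ a₂ b₁ b₂ α β : ℝ} (ha₁ : 0 ≤ a₁) (ha₂ : 0 ≤ a₂) (hb₁ : 0 ≤ b₁)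
    (hb₂ : 0 ≤ b₂) (h₁ : b₁ = 0 → a₁ = 0) (h₂ : b₂ = 0 → a₂ = 0) (hα : 0 ≤ α) (hβ : 0 ≤ β) :
    (α * a₁ + β * a₂) * Real.log ((α * a₁ + β * a₂) / (α * b₁ + β * b₂)) ≤
      α * (a₁ * Real.log (a₁ / b₁)) + β * (a₂ * Real.log (a₂ / b₂)) := by
  have key := log_sum_inequality (Finset.univ : Finset (Fin 2))
    (a := ![α * a₁, β * a₂]) (b := ![α * b₁, β * b₂])
    (by intro i _; fin_cases i <;> simp <;> positivity)
    (by intro i _; fin_cases i <;> simp <;> positivity)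
    (by
      intro i _
      fin_cases i
      · simp only [Fin.zero_eta, Matrix.cons_val_zero, mul_eq_zero]; tauto
      · simp only [Fin.mk_one, Matrix.cons_val_one, Matrix.cons_val_fin_one, mul_eq_zero]; tauto)
  simp only [Fin.sum_univ_two, Matrix.cons_val_zero, Matrix.cons_val_one,
    Matrix.cons_val_fin_one] at key
  refine key.trans (le_of_eq ?_)
  have scale : ∀ γ a b : ℝ, γ * a * Real.log (γ * a / (γ * b)) = γ * (a * Real.log (a / b)) := by
    intro γ a b
    rcases eq_or_ne γ 0 with rfl | hγ
    · simp
    · rw [mul_div_mul_left _ _ hγ, mul_assoc]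
  rw [scale, scale]

/-! ### Extended-real sums -/

theorem EReal.coe_sum_real {ι : Type*} (s : Finset ι) (f : ι → ℝ) :
    ((∑ i ∈ s, f i : ℝ) : EReal) = ∑ i ∈ s, (f i : EReal) := by
  classical
  induction s using Finset.induction_on with
  | empty => simp
  | insert a s ha ih => rw [Finset.sum_insert ha, Finset.sum_insert ha, EReal.coe_add, ih]

theorem EReal.sum_ne_bot {ι : Type*} {s : Finset ι} {f : ι → EReal} (h : ∀ i ∈ s, f i ≠ ⊥) :
    ∑ i ∈ s, f i ≠ ⊥ := by
  classical
  induction s using Finset.induction_on with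
  | empty => simp
  | insert a s ha ih =>
    rw [Finset.sum_insert ha]
    exact EReal.add_ne_bot_iff.2 ⟨h a (by simp), ih fun i hi => h i (by simp [hi])⟩

theorem EReal.sum_eq_top {ι : Type*} {s : Finset ι} {f : ι → EReal} (h : ∀ i ∈ s, f i ≠ ⊥)
    {j : ι} (hj : j ∈ s) (hfj : f j = ⊤) : ∑ i ∈ s, f i = ⊤ := by
  classical
  rw [← Finset.add_sum_erase s f hj, hfj]
  exact EReal.top_add_of_ne_bot (EReal.sum_ne_bot fun i hi => h i (Finset.mem_of_mem_erase hi))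

theorem EReal.sum_eq_bot {ι : Type*} {s : Finset ι} {f : ι → EReal} {j : ι} (hj : j ∈ s)
    (hfj : f j = ⊥) : ∑ i ∈ s, f i = ⊥ := by
  classical
  rw [← Finset.add_sum_erase s f hj, hfj, EReal.bot_add]

/-! ### The source exponent -/

theorem continuous_entropy {α : Type*} [Fintype α] :
    Continuous (entropy : (α → ℝ) → ℝ) := by
  unfold entropy
  exact (continuous_finsetSum _ fun a _ => Real.continuous_mul_log.comp (continuous_apply a)).neg

theorem entropy_nonneg {α : Type*} [Fintype α] {P : α → ℝ} (hP : P ∈ stdSimplex ℝ α) :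
    0 ≤ entropy P := by
  rw [entropy, neg_nonneg]
  exact Finset.sum_nonpos fun a _ => Real.mul_log_nonpos (hP.1 a)
    (hP.2 ▸ Finset.single_le_sum (fun b _ => hP.1 b) (Finset.mem_univ a))

theorem concaveOn_entropy {α : Type*} [Fintype α] :
    ConcaveOn ℝ (stdSimplex ℝ α) (entropy : (α → ℝ) → ℝ) := by
  refine ⟨convex_stdSimplex ℝ α, fun P hP Q hQ a b ha hb hab => ?_⟩
  simp only [entropy, smul_eq_mul, Pi.add_apply, Pi.smul_apply, mul_neg, ← neg_add,
    Finset.mul_sum, ← Finset.sum_add_distrib, neg_le_neg_iff]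
  exact Finset.sum_le_sum fun i _ => Real.convexOn_mul_log.2 (hP.1 i) (hQ.1 i) ha hb hab

/-- The distributions absolutely continuous with respect to `PV`. -/
noncomputable def acDist {V : Type*} [Fintype V] (PV : V → ℝ) : Set (V → ℝ) :=
  {Q | Q ∈ stdSimplex ℝ V ∧ ∀ v, PV v = 0 → Q v = 0}

/-- The cross entropy `-∑ Q log P`. -/
noncomputable def crossEntropy {V : Type*} [Fintype V] (PV Q : V → ℝ) : ℝ := -∑ v, Q v * Real.log (PV v)

section Source

variable {V : Type*} [Fintype V] {PV : V → ℝ}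

theorem continuous_crossEntropy : Continuous (crossEntropy PV) := by
  unfold crossEntropy
  fun_prop

theorem crossEntropy_combo (P Q : V → ℝ) (a b : ℝ) :
    crossEntropy PV (a • P + b • Q) = a * crossEntropy PV P + b * crossEntropy PV Q := by
  simp only [crossEntropy, Pi.add_apply, Pi.smul_apply, smul_eq_mul, mul_neg, ← neg_add,
    Finset.mul_sum, ← Finset.sum_add_distrib]
  congr 1
  exact Finset.sum_congr rfl fun v _ => by ring

theorem convex_acDist : Convex ℝ (acDist PV) := by
  refine fun P hP Q hQ a b ha hb hab => ⟨convex_stdSimplex ℝ V hP.1 hQ.1 ha hb hab, fun v hv => ?_⟩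
  simp [hP.2 v hv, hQ.2 v hv]

theorem isCompact_acDist : IsCompact (acDist PV) := by
  have : acDist PV = stdSimplex ℝ V ∩ ⋂ v, {Q : V → ℝ | PV v = 0 → Q v = 0} := by
    ext Q
    simp [acDist]
  rw [this]
  refine (isCompact_stdSimplex ℝ V).inter_right (isClosed_iInter fun v => ?_)
  by_cases hv : PV v = 0
  · simpa [hv] using isClosed_eq (continuous_apply v) continuous_const
  · simp [hv]

theorem relEntropy_of_mem {Q : V → ℝ} (hQ : Q ∈ acDist PV) :
    relEntropy Q PV = ((crossEntropy PV Q - entropy Q : ℝ) : EReal) := by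
  rw [relEntropy, if_pos hQ.2, crossEntropy, entropy, neg_sub_neg, ← Finset.sum_sub_distrib]
  congr 1
  refine Finset.sum_congr rfl fun v _ => ?_
  by_cases hQv : Q v = 0
  · simp [hQv]
  · rw [Real.log_div hQv fun h => hQv (hQ.2 v h), mul_sub]

theorem relEntropy_of_notMem {Q : V → ℝ} (hQ : Q ∈ stdSimplex ℝ V) (hQ' : Q ∉ acDist PV) :
    relEntropy Q PV = ⊤ := by
  rw [relEntropy, if_neg fun h => hQ' ⟨hQ, h⟩]

/-- Gibbs variational bound: `-E_s(λ) ≤ D(Q‖P) - λ H(Q)`. -/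
theorem neg_Es_le (hPV : PV ∈ stdSimplex ℝ V) {lam : ℝ} (hl : 0 ≤ lam) {Q : V → ℝ}
    (hQ : Q ∈ acDist PV) :
    -Es PV lam ≤ crossEntropy PV Q - (1 + lam) * entropy Q := by
  have hl1 : 0 < 1 + lam := by linarith
  have key := log_sum_inequality (Finset.univ : Finset V) (a := Q)
    (b := fun v => PV v ^ (1 / (1 + lam))) (fun v _ => hQ.1.1 v)
    (fun v _ => Real.rpow_nonneg (hPV.1 v) _)
    (fun v _ h => hQ.2 v ((Real.rpow_eq_zero (hPV.1 v) (by positivity)).1 h))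
  rw [hQ.1.2, one_mul, one_div (∑ v, PV v ^ (1 / (1 + lam))), Real.log_inv] at key
  have h2 : ∑ v, Q v * Real.log (Q v / PV v ^ (1 / (1 + lam))) =
      -entropy Q + 1 / (1 + lam) * crossEntropy PV Q := by
    rw [entropy, crossEntropy, neg_neg, mul_neg, ← sub_eq_add_neg, Finset.mul_sum,
      ← Finset.sum_sub_distrib]
    refine Finset.sum_congr rfl fun v _ => ?_
    by_cases hQv : Q v = 0
    · simp [hQv]
    have hP : 0 < PV v := lt_of_le_of_ne (hPV.1 v) fun h => hQv (hQ.2 v h.symm)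
    rw [Real.log_div hQv (by positivity), Real.log_rpow hP]
    ring
  rw [h2] at key
  have h3 := mul_le_mul_of_nonneg_left key hl1.le
  have h4 : (1 + lam) * (-entropy Q + 1 / (1 + lam) * crossEntropy PV Q) =
      crossEntropy PV Q - (1 + lam) * entropy Q := by
    field_simp
    ring
  rw [Es]
  linarith

/-- The bound `neg_Es_le` is attained by the tilted distribution. -/
theorem exists_eq_neg_Es (hPV : PV ∈ stdSimplex ℝ V) {lam : ℝ} (hl : 0 ≤ lam) :
    ∃ Q ∈ acDist PV, crossEntropy PV Q - (1 + lam) * entropy Q = -Es PV lam := by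
  have hl1 : 0 < 1 + lam := by linarith
  set S := ∑ v, PV v ^ (1 / (1 + lam)) with hS
  have hnn : ∀ v, 0 ≤ PV v ^ (1 / (1 + lam)) := fun v => Real.rpow_nonneg (hPV.1 v) _
  have hSpos : 0 < S := by
    refine lt_of_le_of_ne (Finset.sum_nonneg fun v _ => hnn v) fun h => ?_
    have h0 : ∑ v, PV v = 0 := Finset.sum_eq_zero fun v hv =>
      (Real.rpow_eq_zero (hPV.1 v) (by positivity)).1
        ((Finset.sum_eq_zero_iff_of_nonneg fun v _ => hnn v).1 h.symm v hv)
    rw [hPV.2] at h0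
    exact one_ne_zero h0
  refine ⟨fun v => PV v ^ (1 / (1 + lam)) / S, ⟨⟨fun v => div_nonneg (hnn v) hSpos.le, ?_⟩, ?_⟩, ?_⟩
  · rw [← Finset.sum_div, ← hS, div_self hSpos.ne']
  · intro v hv
    simp only [hv]
    rw [Real.zero_rpow (by positivity), zero_div]
  · have hsum : ∑ v, PV v ^ (1 / (1 + lam)) / S = 1 := by
      rw [← Finset.sum_div, ← hS, div_self hSpos.ne']
    rw [crossEntropy, entropy, Es, ← hS, mul_neg, sub_neg_eq_add, Finset.mul_sum,
      ← Finset.sum_neg_distrib, ← Finset.sum_add_distrib]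
    calc _ = ∑ v, PV v ^ (1 / (1 + lam)) / S * (-((1 + lam) * Real.log S)) := by
          refine Finset.sum_congr rfl fun v _ => ?_
          by_cases hv : PV v = 0
          · rw [hv, Real.zero_rpow (by positivity)]
            simp
          have hP : 0 < PV v := lt_of_le_of_ne (hPV.1 v) (Ne.symm hv)
          rw [Real.log_div (by positivity) hSpos.ne', Real.log_rpow hP]
          field_simp
          ring
      _ = _ := by rw [← Finset.sum_mul, hsum, one_mul]

/-- Weak duality for the source exponent. -/
theorem mul_sub_Es_le_srcRel (hPV : PV ∈ stdSimplex ℝ V) {lam : ℝ} (hl : 0 ≤ lam) (r : ℝ) :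
    ((lam * r - Es PV lam : ℝ) : EReal) ≤ srcRel PV r := by
  refine le_iInf₂ fun Q hQ => le_iInf fun hr => ?_
  by_cases hQ' : Q ∈ acDist PV
  · rw [relEntropy_of_mem hQ', EReal.coe_le_coe_iff]
    nlinarith [neg_Es_le hPV hl hQ', mul_le_mul_of_nonneg_left hr hl]
  · rw [relEntropy_of_notMem hQ hQ']
    exact le_top

end Source

/-! ### Mutual information -/

/-- The second marginal of a joint distribution. -/
noncomputable def sndMarginal {X : Type*} [Fintype X] (P : X × X → ℝ) (x' : X) : ℝ := ∑ x, P (x, x')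

section MutualInfo

variable {X : Type*} [Fintype X]

/-- `I(X; X̄)` when the first marginal is `Q`. -/
theorem mutualInfo_eq {P : X × X → ℝ} {Q : X → ℝ} (hQ : ∀ x, ∑ x', P (x, x') = Q x) :
    mutualInfo P = ∑ p, P p * Real.log (P p / (Q p.1 * sndMarginal P p.2)) := by
  simp only [mutualInfo, hQ, sndMarginal]

theorem le_fstMarginal {P : X × X → ℝ} (hP : ∀ p, 0 ≤ P p) (p : X × X) :
    P p ≤ ∑ x', P (p.1, x') :=
  Finset.single_le_sum (f := fun x' => P (p.1, x')) (fun _ _ => hP _) (Finset.mem_univ p.2)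

theorem le_sndMarginal {P : X × X → ℝ} (hP : ∀ p, 0 ≤ P p) (p : X × X) :
    P p ≤ sndMarginal P p.2 :=
  Finset.single_le_sum (f := fun x => P (x, p.2)) (fun _ _ => hP _) (Finset.mem_univ p.1)

theorem sndMarginal_mem_stdSimplex {P : X × X → ℝ} (hP : P ∈ stdSimplex ℝ (X × X)) :
    sndMarginal P ∈ stdSimplex ℝ X := by
  refine ⟨fun x' => Finset.sum_nonneg fun x _ => hP.1 _, ?_⟩
  rw [← hP.2, Fintype.sum_prod_type_right]
  rfl

/-- Mutual information as a combination of entropies. -/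
theorem mutualInfo_eq_entropy {P : X × X → ℝ} (hP : ∀ p, 0 ≤ P p) :
    mutualInfo P = entropy (fun x => ∑ x', P (x, x')) + entropy (sndMarginal P) - entropy P := by
  have h1 : ∑ x, (∑ x', P (x, x')) * Real.log (∑ x', P (x, x')) =
      ∑ p : X × X, P p * Real.log (∑ x', P (p.1, x')) := by
    rw [Fintype.sum_prod_type]
    exact Finset.sum_congr rfl fun x _ => Finset.sum_mul _ _ _
  have h2 : ∑ x', sndMarginal P x' * Real.log (sndMarginal P x') =
      ∑ p : X × X, P p * Real.log (sndMarginal P p.2) := by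
    rw [Fintype.sum_prod_type_right]
    exact Finset.sum_congr rfl fun x _ => Finset.sum_mul _ _ _
  rw [mutualInfo_eq fun _ => rfl, entropy, entropy, entropy, h1, h2, sub_neg_eq_add,
    ← neg_add, neg_add_eq_sub, ← Finset.sum_add_distrib, ← Finset.sum_sub_distrib]
  refine Finset.sum_congr rfl fun p _ => ?_
  rcases (hP p).eq_or_lt with h0 | h0
  · simp [← h0]
  have hm1 := h0.trans_le (le_fstMarginal hP p)
  have hm2 := h0.trans_le (le_sndMarginal hP p)
  rw [Real.log_div h0.ne' (by positivity), Real.log_mul hm1.ne' hm2.ne']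
  ring

theorem continuousOn_mutualInfo : ContinuousOn mutualInfo (stdSimplex ℝ (X × X)) := by
  have h : Continuous fun P : X × X → ℝ =>
      entropy (fun x => ∑ x', P (x, x')) + entropy (sndMarginal P) - entropy P := by
    unfold sndMarginal
    refine ((continuous_entropy.comp ?_).add (continuous_entropy.comp ?_)).sub continuous_entropy
    all_goals fun_prop
  exact h.continuousOn.congr fun P hP => mutualInfo_eq_entropy hP.1

/-- `I(X; X̄)` is at most the divergence from any product with the right first marginal. -/
theorem mutualInfo_le {P : X × X → ℝ} (hP : P ∈ stdSimplex ℝ (X × X)) {Q Q' : X → ℝ}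
    (hQ : ∀ x, ∑ x', P (x, x') = Q x) (hQ' : Q' ∈ stdSimplex ℝ X)
    (hPQ' : ∀ p, Q' p.2 = 0 → P p = 0) :
    mutualInfo P ≤ ∑ p, P p * Real.log (P p / (Q p.1 * Q' p.2)) := by
  have hm := sndMarginal_mem_stdSimplex hP
  have key := log_sum_inequality (Finset.univ : Finset X) (a := sndMarginal P) (b := Q')
    (fun x _ => hm.1 x) (fun x _ => hQ'.1 x)
    (fun x' _ h => Finset.sum_eq_zero fun x _ => hPQ' (x, x') h)
  rw [hm.2, hQ'.2, div_one, Real.log_one, mul_zero] at key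
  have h2 : ∑ x', sndMarginal P x' * Real.log (sndMarginal P x' / Q' x') =
      ∑ p : X × X, P p * Real.log (sndMarginal P p.2 / Q' p.2) := by
    rw [Fintype.sum_prod_type_right]
    exact Finset.sum_congr rfl fun x _ => Finset.sum_mul _ _ _
  rw [h2] at key
  have h3 : ∑ p, P p * Real.log (P p / (Q p.1 * Q' p.2)) =
      mutualInfo P + ∑ p : X × X, P p * Real.log (sndMarginal P p.2 / Q' p.2) := by
    rw [mutualInfo_eq hQ, ← Finset.sum_add_distrib]
    refine Finset.sum_congr rfl fun p _ => ?_
    rcases (hP.1 p).eq_or_lt with h0 | h0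
    · simp [← h0]
    have hm1 : 0 < Q p.1 := hQ p.1 ▸ h0.trans_le (le_fstMarginal hP.1 p)
    have hm2 := h0.trans_le (le_sndMarginal hP.1 p)
    have hm3 : Q' p.2 ≠ 0 := fun h => h0.ne' (hPQ' p h)
    rw [Real.log_div h0.ne' (by positivity), Real.log_mul hm1.ne' hm3,
      Real.log_div h0.ne' (by positivity), Real.log_mul hm1.ne' hm2.ne', Real.log_div hm2.ne' hm3]
    ring
  linarith

end MutualInfo

/-! ### The weak expurgated exponent and its dual -/

/-- The Bhattacharyya coefficient `∑_y √(W(y|x) W(y|x̄)) = exp (-d_B(x, x̄))`. -/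
noncomputable def bhattCoeff {X Y : Type*} [Fintype Y] (W : X → Y → ℝ) (x x' : X) : ℝ := ∑ y, √(W x y * W x' y)

/-- The joint distributions with first marginal `Q` for which `𝔼[d_B]` is finite. -/
noncomputable def finiteJoint {X Y : Type*} [Fintype X] [Fintype Y] (W : X → Y → ℝ) (Q : X → ℝ) :
    Set (X × X → ℝ) :=
  {P | P ∈ stdSimplex ℝ (X × X) ∧ (∀ x, ∑ x', P (x, x') = Q x) ∧
    ∀ p, bhattCoeff W p.1 p.2 = 0 → P p = 0}

/-- The real number `𝔼_P[d_B(X, X̄)]`, meaningful on `finiteJoint`. -/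
noncomputable def meanDist {X Y : Type*} [Fintype X] [Fintype Y] (W : X → Y → ℝ) (P : X × X → ℝ) : ℝ :=
  ∑ p, P p * -Real.log (bhattCoeff W p.1 p.2)

section Bhattacharyya

variable {X Y : Type*} [Fintype Y] {W : X → Y → ℝ}

theorem bhattCoeff_nonneg (W : X → Y → ℝ) (x x' : X) : 0 ≤ bhattCoeff W x x' :=
  Finset.sum_nonneg fun _ _ => Real.sqrt_nonneg _

theorem dB_eq_top {x x' : X} (h : bhattCoeff W x x' = 0) : dB W x x' = ⊤ := by
  rw [bhattCoeff] at h
  simp [dB, h]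

theorem dB_eq_coe {x x' : X} (h : bhattCoeff W x x' ≠ 0) :
    dB W x x' = ((-Real.log (bhattCoeff W x x') : ℝ) : EReal) := by
  rw [dB, ← bhattCoeff,
    ENNReal.log_ofReal_of_pos (lt_of_le_of_ne (bhattCoeff_nonneg W x x') h.symm), EReal.coe_neg]

theorem exp_neg_dB_div {ρ : ℝ} (hρ : 0 < ρ) (x x' : X) :
    EReal.exp (-(dB W x x' / (ρ : EReal))) = ENNReal.ofReal (bhattCoeff W x x' ^ (1 / ρ)) := by
  by_cases h : bhattCoeff W x x' = 0
  · rw [dB_eq_top h, h, Real.zero_rpow (by positivity),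
      EReal.top_div_of_pos_ne_top (by exact_mod_cast hρ) (EReal.coe_ne_top _)]
    simp
  · rw [dB_eq_coe h, ← EReal.coe_div, ← EReal.coe_neg, EReal.exp_coe,
      Real.rpow_def_of_pos (lt_of_le_of_ne (bhattCoeff_nonneg W x x') (Ne.symm h))]
    congr 2
    ring

end Bhattacharyya

section Channel

variable {X Y : Type*} [Fintype X] [Fintype Y] {W : X → Y → ℝ} {Q : X → ℝ}

theorem sum_mul_dB_of_mem {P : X × X → ℝ} (hP : P ∈ finiteJoint W Q) :
    ∑ p : X × X, (P p : EReal) * dB W p.1 p.2 = (meanDist W P : EReal) := by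
  rw [meanDist, EReal.coe_sum_real]
  refine Finset.sum_congr rfl fun p _ => ?_
  by_cases h : bhattCoeff W p.1 p.2 = 0
  · simp [hP.2.2 p h]
  · rw [dB_eq_coe h, EReal.coe_mul]

theorem sum_mul_dB_of_notMem {P : X × X → ℝ} (hP : P ∈ stdSimplex ℝ (X × X))
    (hQ : ∀ x, ∑ x', P (x, x') = Q x) (hP' : P ∉ finiteJoint W Q) :
    ∑ p : X × X, (P p : EReal) * dB W p.1 p.2 = ⊤ := by
  have : ∃ p : X × X, bhattCoeff W p.1 p.2 = 0 ∧ P p ≠ 0 := by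
    by_contra hne
    push Not at hne
    exact hP' ⟨hP, hQ, hne⟩
  obtain ⟨p, hp, hPp⟩ := this
  have hpos : 0 < P p := lt_of_le_of_ne (hP.1 p) hPp.symm
  refine EReal.sum_eq_top (fun q _ => ?_) (Finset.mem_univ p) ?_
  · rcases (hP.1 q).eq_or_lt with h0 | h0
    · simp [← h0]
    · by_cases h : bhattCoeff W q.1 q.2 = 0
      · rw [dB_eq_top h, EReal.coe_mul_top_of_pos h0]
        exact top_ne_bot
      · rw [dB_eq_coe h, ← EReal.coe_mul]
        exact EReal.coe_ne_bot _
  · rw [dB_eq_top hp, EReal.coe_mul_top_of_pos hpos]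

theorem EexWeak_le {P : X × X → ℝ} {R : ℝ} (hP : P ∈ finiteJoint W Q) (hR : mutualInfo P ≤ R) :
    EexWeak W Q R ≤ ((meanDist W P + mutualInfo P - R : ℝ) : EReal) := by
  refine (iInf₂_le P hP.1).trans ((iInf₂_le hP.2.1 hR).trans (le_of_eq ?_))
  rw [sum_mul_dB_of_mem hP, EReal.coe_sub, EReal.coe_add]

theorem le_EexWeak {R : ℝ} {a : EReal} (h : ∀ P ∈ finiteJoint W Q, mutualInfo P ≤ R →
    a ≤ ((meanDist W P + mutualInfo P - R : ℝ) : EReal)) : a ≤ EexWeak W Q R := by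
  refine le_iInf₂ fun P hP => le_iInf₂ fun hQ hR => ?_
  by_cases hP' : P ∈ finiteJoint W Q
  · rw [sum_mul_dB_of_mem hP', ← EReal.coe_add, ← EReal.coe_sub]
    exact h P hP' hR
  · rw [sum_mul_dB_of_notMem hP hQ hP', EReal.top_add_coe, EReal.top_sub_coe]
    exact le_top

theorem convex_finiteJoint : Convex ℝ (finiteJoint W Q) := by
  refine fun P hP P' hP' a b ha hb hab =>
    ⟨convex_stdSimplex ℝ _ hP.1 hP'.1 ha hb hab, fun x => ?_, fun p hp => ?_⟩
  · simp only [Pi.add_apply, Pi.smul_apply, smul_eq_mul, Finset.sum_add_distrib, ← Finset.mul_sum,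
      hP.2.1, hP'.2.1]
    rw [← add_mul, hab, one_mul]
  · simp [hP.2.2 p hp, hP'.2.2 p hp]

theorem isCompact_finiteJoint : IsCompact (finiteJoint W Q) := by
  have : finiteJoint W Q = stdSimplex ℝ (X × X) ∩
      ((⋂ x, {P : X × X → ℝ | ∑ x', P (x, x') = Q x}) ∩
        ⋂ p : X × X, {P : X × X → ℝ | bhattCoeff W p.1 p.2 = 0 → P p = 0}) := by
    ext P
    simp only [finiteJoint, Set.mem_ofPred_eq, Set.mem_inter_iff, Set.mem_iInter]
  rw [this]
  refine (isCompact_stdSimplex ℝ _).inter_right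
    ((isClosed_iInter fun x => isClosed_eq (by fun_prop) continuous_const).inter
      (isClosed_iInter fun p => ?_))
  by_cases hp : bhattCoeff W p.1 p.2 = 0
  · simpa [hp] using isClosed_eq (continuous_apply p) continuous_const
  · simp [hp]

theorem finiteJoint_nonempty (hW : IsStochastic W) (hQ : Q ∈ stdSimplex ℝ X) :
    (finiteJoint W Q).Nonempty := by
  classical
  refine ⟨fun p => if p.1 = p.2 then Q p.1 else 0, ⟨fun p => ?_, ?_⟩, fun x => ?_, fun p hp => ?_⟩
  · dsimp only
    split_ifs
    exacts [hQ.1 _, le_rfl]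
  · rw [Fintype.sum_prod_type]
    simpa using hQ.2
  · simp
  · have hne : p.1 ≠ p.2 := by
      intro h
      rw [← h, bhattCoeff] at hp
      simp only [Real.sqrt_mul_self ((hW p.1).1 _)] at hp
      exact one_ne_zero ((hW p.1).2.symm.trans hp)
    simp [hne]

theorem continuousOn_mutualInfo_finiteJoint : ContinuousOn mutualInfo (finiteJoint W Q) :=
  continuousOn_mutualInfo.mono fun _ hP => hP.1

theorem continuous_meanDist : Continuous (meanDist W) := by
  unfold meanDist
  fun_prop

theorem convexOn_meanDist : ConvexOn ℝ (finiteJoint W Q) (meanDist W) := by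
  refine ⟨convex_finiteJoint, fun P _ P' _ a b _ _ _ => le_of_eq ?_⟩
  simp only [meanDist, Pi.add_apply, Pi.smul_apply, smul_eq_mul, Finset.mul_sum,
    ← Finset.sum_add_distrib]
  exact Finset.sum_congr rfl fun p _ => by ring

theorem convexOn_mutualInfo : ConvexOn ℝ (finiteJoint W Q) mutualInfo := by
  refine ⟨convex_finiteJoint, fun P hP P' hP' a b ha hb hab => ?_⟩
  have hnull : ∀ P ∈ finiteJoint W Q, ∀ p, Q p.1 * sndMarginal P p.2 = 0 → P p = 0 := by
    intro P hP p h
    rcases mul_eq_zero.1 h with h | h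
    · exact le_antisymm (h ▸ hP.2.1 p.1 ▸ le_fstMarginal hP.1.1 p) (hP.1.1 p)
    · exact le_antisymm (h ▸ le_sndMarginal hP.1.1 p) (hP.1.1 p)
  have hnn : ∀ P ∈ finiteJoint W Q, ∀ p : X × X, 0 ≤ Q p.1 * sndMarginal P p.2 := fun P hP p =>
    mul_nonneg (hP.2.1 p.1 ▸ Finset.sum_nonneg fun _ _ => hP.1.1 _)
      (Finset.sum_nonneg fun _ _ => hP.1.1 _)
  rw [mutualInfo_eq (convex_finiteJoint hP hP' ha hb hab).2.1, mutualInfo_eq hP.2.1,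
    mutualInfo_eq hP'.2.1, smul_eq_mul, smul_eq_mul, Finset.mul_sum, Finset.mul_sum,
    ← Finset.sum_add_distrib]
  refine Finset.sum_le_sum fun p _ => ?_
  have hm : Q p.1 * sndMarginal (a • P + b • P') p.2 =
      a * (Q p.1 * sndMarginal P p.2) + b * (Q p.1 * sndMarginal P' p.2) := by
    simp only [sndMarginal, Pi.add_apply, Pi.smul_apply, smul_eq_mul, Finset.sum_add_distrib,
      ← Finset.mul_sum]
    ring
  rw [hm]
  exact mul_log_div_convex (hP.1.1 p) (hP'.1.1 p) (hnn P hP p) (hnn P' hP' p) (hnull P hP p)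
    (hnull P' hP' p) ha hb

/-- `∑_x̄ Q'(x̄) exp (-d_B(x, x̄)/ρ)` as a real number. -/
noncomputable def tiltSum (W : X → Y → ℝ) (Q' : X → ℝ) (ρ : ℝ) (x : X) : ℝ :=
  ∑ x', Q' x' * bhattCoeff W x x' ^ (1 / ρ)

theorem tiltSum_nonneg {Q' : X → ℝ} (hQ' : Q' ∈ stdSimplex ℝ X) (ρ : ℝ) (x : X) :
    0 ≤ tiltSum W Q' ρ x :=
  Finset.sum_nonneg fun x' _ => mul_nonneg (hQ'.1 x') (Real.rpow_nonneg (bhattCoeff_nonneg W x x') _)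

theorem sum_ofReal_mul_exp {Q' : X → ℝ} (hQ' : Q' ∈ stdSimplex ℝ X) {ρ : ℝ} (hρ : 0 < ρ) (x : X) :
    ∑ x', ENNReal.ofReal (Q' x') * EReal.exp (-(dB W x x' / (ρ : EReal))) =
      ENNReal.ofReal (tiltSum W Q' ρ x) := by
  rw [tiltSum, ENNReal.ofReal_sum_of_nonneg fun x' _ =>
    mul_nonneg (hQ'.1 x') (Real.rpow_nonneg (bhattCoeff_nonneg W x x') _)]
  exact Finset.sum_congr rfl fun x' _ => by
    rw [exp_neg_dB_div hρ, ENNReal.ofReal_mul (hQ'.1 x')]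

theorem ExWeak_objective_eq_coe {Q' : X → ℝ} (hQ' : Q' ∈ stdSimplex ℝ X) {ρ : ℝ} (hρ : 0 < ρ)
    (hz : ∀ x, Q x ≠ 0 → tiltSum W Q' ρ x ≠ 0) :
    -((ρ : EReal) * ∑ x, (Q x : EReal) *
      ENNReal.log (∑ x', ENNReal.ofReal (Q' x') * EReal.exp (-(dB W x x' / (ρ : EReal))))) =
      ((-(ρ * ∑ x, Q x * Real.log (tiltSum W Q' ρ x)) : ℝ) : EReal) := by
  rw [EReal.coe_neg, EReal.coe_mul, EReal.coe_sum_real]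
  congr 2
  refine Finset.sum_congr rfl fun x _ => ?_
  rw [sum_ofReal_mul_exp hQ' hρ]
  by_cases hx : Q x = 0
  · simp [hx]
  · rw [ENNReal.log_ofReal_of_pos (lt_of_le_of_ne (tiltSum_nonneg hQ' ρ x) (hz x hx).symm),
      EReal.coe_mul]

theorem ExWeak_objective_eq_top (hQ : Q ∈ stdSimplex ℝ X) {Q' : X → ℝ} (hQ' : Q' ∈ stdSimplex ℝ X)
    {ρ : ℝ} (hρ : 0 < ρ) {x : X} (hx : Q x ≠ 0) (hz : tiltSum W Q' ρ x = 0) :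
    -((ρ : EReal) * ∑ x, (Q x : EReal) *
      ENNReal.log (∑ x', ENNReal.ofReal (Q' x') * EReal.exp (-(dB W x x' / (ρ : EReal))))) = ⊤ := by
  have hQx : 0 < Q x := lt_of_le_of_ne (hQ.1 x) hx.symm
  rw [EReal.sum_eq_bot (Finset.mem_univ x), EReal.coe_mul_bot_of_pos hρ, EReal.neg_bot]
  rw [sum_ofReal_mul_exp hQ' hρ, hz, ENNReal.ofReal_zero, ENNReal.log_zero,
    EReal.coe_mul_bot_of_pos hQx]

theorem ExWeak_le (hQ : Q ∈ stdSimplex ℝ X) {P : X × X → ℝ} (hP : P ∈ finiteJoint W Q) {ρ : ℝ}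
    (hρ : 0 < ρ) :
    ExWeak W Q ρ ≤ ((meanDist W P + ρ * mutualInfo P : ℝ) : EReal) := by
  have hm := sndMarginal_mem_stdSimplex hP.1
  have hterm : ∀ p : X × X, 0 ≤ sndMarginal P p.2 * bhattCoeff W p.1 p.2 ^ (1 / ρ) := fun p =>
    mul_nonneg (hm.1 _) (Real.rpow_nonneg (bhattCoeff_nonneg W _ _) _)
  have hpos : ∀ p, P p ≠ 0 → 0 < sndMarginal P p.2 ∧ 0 < bhattCoeff W p.1 p.2 := fun p hp =>
    ⟨(lt_of_le_of_ne (hP.1.1 p) hp.symm).trans_le (le_sndMarginal hP.1.1 p),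
      lt_of_le_of_ne (bhattCoeff_nonneg W _ _) fun h => hp (hP.2.2 p h.symm)⟩
  have hz : ∀ x, Q x ≠ 0 → tiltSum W (sndMarginal P) ρ x ≠ 0 := by
    intro x hx h0
    refine hx ?_
    rw [← hP.2.1 x]
    refine Finset.sum_eq_zero fun x' hx' => ?_
    by_contra hne
    obtain ⟨h1, h2⟩ := hpos _ hne
    have := (Finset.sum_eq_zero_iff_of_nonneg fun x' _ => hterm (x, x')).1 h0 x' hx'
    exact (mul_pos h1 (Real.rpow_pos_of_pos h2 _)).ne' this
  refine (iInf₂_le (sndMarginal P) hm).trans ?_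
  rw [ExWeak_objective_eq_coe hm hρ hz, EReal.coe_le_coe_iff]
  have key : ∀ x, -(Q x * Real.log (tiltSum W (sndMarginal P) ρ x)) ≤
      ∑ x', P (x, x') * Real.log (P (x, x') /
        (Q x * (sndMarginal P x' * bhattCoeff W x x' ^ (1 / ρ)))) := by
    intro x
    have h := log_sum_inequality (Finset.univ : Finset X) (a := fun x' => P (x, x'))
      (b := fun x' => Q x * (sndMarginal P x' * bhattCoeff W x x' ^ (1 / ρ)))
      (fun x' _ => hP.1.1 _) (fun x' _ => mul_nonneg (hQ.1 x) (hterm (x, x')))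
      (fun x' _ h => by
        by_contra hne
        obtain ⟨h1, h2⟩ := hpos _ hne
        have h3 : 0 < Q x := hP.2.1 x ▸
          (lt_of_le_of_ne (hP.1.1 _) (Ne.symm hne)).trans_le (le_fstMarginal hP.1.1 (x, x'))
        exact (mul_pos h3 (mul_pos h1 (Real.rpow_pos_of_pos h2 _))).ne' h)
    refine le_trans (le_of_eq ?_) h
    rw [hP.2.1 x, ← Finset.mul_sum, ← tiltSum]
    by_cases hx : Q x = 0
    · simp [hx]
    · rw [div_mul_cancel_left₀ hx, Real.log_inv, mul_neg]
  have hsum := Finset.sum_le_sum fun x (_ : x ∈ (Finset.univ : Finset X)) => key x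
  have h2 : ∑ x, ∑ x', P (x, x') * Real.log (P (x, x') /
        (Q x * (sndMarginal P x' * bhattCoeff W x x' ^ (1 / ρ)))) =
      mutualInfo P + 1 / ρ * meanDist W P := by
    rw [mutualInfo_eq hP.2.1, meanDist, Finset.mul_sum, ← Finset.sum_add_distrib,
      Fintype.sum_prod_type]
    refine Finset.sum_congr rfl fun x _ => Finset.sum_congr rfl fun x' _ => ?_
    by_cases h0 : P (x, x') = 0
    · simp [h0]
    obtain ⟨h1, h2⟩ := hpos _ h0
    have h3 : 0 < Q x := hP.2.1 x ▸
      (lt_of_le_of_ne (hP.1.1 _) (Ne.symm h0)).trans_le (le_fstMarginal hP.1.1 (x, x'))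
    have h4 := Real.rpow_pos_of_pos h2 (1 / ρ)
    dsimp only at h1 h2 h4 ⊢
    rw [← mul_assoc, ← div_div, Real.log_div (div_ne_zero h0 (by positivity)) h4.ne',
      Real.log_rpow h2]
    ring
  rw [h2, Finset.sum_neg_distrib] at hsum
  have h3 := mul_le_mul_of_nonneg_left hsum hρ.le
  have h4 : ρ * (mutualInfo P + 1 / ρ * meanDist W P) = meanDist W P + ρ * mutualInfo P := by
    field_simp
    ring
  linarith

/-- The tilted joint distribution does at least as well as a given output distribution. -/
theorem exists_finiteJoint_le (hQ : Q ∈ stdSimplex ℝ X) {Q' : X → ℝ} (hQ' : Q' ∈ stdSimplex ℝ X)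
    {ρ : ℝ} (hρ : 0 < ρ) (hz : ∀ x, Q x ≠ 0 → tiltSum W Q' ρ x ≠ 0) :
    ∃ P ∈ finiteJoint W Q, meanDist W P + ρ * mutualInfo P ≤
      -(ρ * ∑ x, Q x * Real.log (tiltSum W Q' ρ x)) := by
  set P : X × X → ℝ := fun p =>
    Q p.1 * (Q' p.2 * bhattCoeff W p.1 p.2 ^ (1 / ρ)) / tiltSum W Q' ρ p.1 with hPdef
  have hmarg : ∀ x, ∑ x', P (x, x') = Q x := by
    intro x
    simp only [hPdef]
    rw [← Finset.sum_div, ← Finset.mul_sum, ← tiltSum]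
    by_cases hx : Q x = 0
    · simp [hx]
    · rw [mul_div_cancel_right₀ _ (hz x hx)]
  have hP : P ∈ finiteJoint W Q := by
    refine ⟨⟨fun p => div_nonneg (mul_nonneg (hQ.1 _) (mul_nonneg (hQ'.1 _)
      (Real.rpow_nonneg (bhattCoeff_nonneg W _ _) _))) (tiltSum_nonneg hQ' _ _), ?_⟩, hmarg, ?_⟩
    · rw [Fintype.sum_prod_type, ← hQ.2]
      exact Finset.sum_congr rfl fun x _ => hmarg x
    · intro p hp
      simp only [hPdef]
      rw [hp, Real.zero_rpow (by positivity)]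
      simp
  refine ⟨P, hP, ?_⟩
  have hI := mutualInfo_le hP.1 hmarg hQ' (fun p h => by simp [hPdef, h])
  have h2 : ∑ p, P p * Real.log (P p / (Q p.1 * Q' p.2)) =
      -(1 / ρ * meanDist W P) - ∑ x, Q x * Real.log (tiltSum W Q' ρ x) := by
    have h3 : ∑ x, Q x * Real.log (tiltSum W Q' ρ x) =
        ∑ p : X × X, P p * Real.log (tiltSum W Q' ρ p.1) := by
      rw [Fintype.sum_prod_type]
      exact Finset.sum_congr rfl fun x _ => by simp only [← Finset.sum_mul, hmarg]
    rw [h3, meanDist, Finset.mul_sum, ← Finset.sum_neg_distrib, ← Finset.sum_sub_distrib]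
    refine Finset.sum_congr rfl fun p _ => ?_
    by_cases h0 : P p = 0
    · simp [h0]
    have hQp : Q p.1 ≠ 0 := fun h => h0 (by simp [hPdef, h])
    have hQp' : Q' p.2 ≠ 0 := fun h => h0 (by simp [hPdef, h])
    have hb : 0 < bhattCoeff W p.1 p.2 :=
      lt_of_le_of_ne (bhattCoeff_nonneg W _ _) fun h => h0 (hP.2.2 p h.symm)
    have h4 : P p / (Q p.1 * Q' p.2) = bhattCoeff W p.1 p.2 ^ (1 / ρ) / tiltSum W Q' ρ p.1 := by
      simp only [hPdef]
      field_simp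
    rw [h4, Real.log_div (Real.rpow_pos_of_pos hb _).ne' (hz _ hQp), Real.log_rpow hb]
    ring
  rw [h2] at hI
  have h3 := mul_le_mul_of_nonneg_left hI hρ.le
  have h4 : ρ * (-(1 / ρ * meanDist W P) - ∑ x, Q x * Real.log (tiltSum W Q' ρ x)) =
      -meanDist W P - ρ * ∑ x, Q x * Real.log (tiltSum W Q' ρ x) := by
    field_simp
  linarith

/-- Variational formula `E'_x(Q, ρ) = min_P 𝔼_P[d_B] + ρ I_P`. -/
theorem exists_ExWeak_eq (hW : IsStochastic W) (hQ : Q ∈ stdSimplex ℝ X) {ρ : ℝ} (hρ : 0 < ρ) :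
    ∃ P ∈ finiteJoint W Q, ExWeak W Q ρ = ((meanDist W P + ρ * mutualInfo P : ℝ) : EReal) := by
  obtain ⟨P, hP, hmin⟩ := isCompact_finiteJoint.exists_isMinOn (finiteJoint_nonempty hW hQ)
    (continuous_meanDist.continuousOn.add
      (continuousOn_mutualInfo_finiteJoint.const_mul ρ) :
        ContinuousOn (fun P => meanDist W P + ρ * mutualInfo P) (finiteJoint W Q))
  refine ⟨P, hP, le_antisymm (ExWeak_le hQ hP hρ) (le_iInf₂ fun Q' hQ' => ?_)⟩
  by_cases hz : ∀ x, Q x ≠ 0 → tiltSum W Q' ρ x ≠ 0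
  · obtain ⟨P', hP', hle⟩ := exists_finiteJoint_le hQ hQ' hρ hz
    rw [ExWeak_objective_eq_coe hQ' hρ hz, EReal.coe_le_coe_iff]
    exact (hmin hP').trans hle
  · push Not at hz
    obtain ⟨x, hx, hzx⟩ := hz
    rw [ExWeak_objective_eq_top hQ hQ' hρ hx hzx]
    exact le_top

/-- Weak duality: `E'_x(Q, ρ) ≤ E'_ex(Q, R) + ρ R` for `ρ ≥ 1`. -/
theorem ExWeak_le_EexWeak_add (hQ : Q ∈ stdSimplex ℝ X) {ρ : ℝ} (hρ : 1 ≤ ρ) (R : ℝ) :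
    ExWeak W Q ρ ≤ EexWeak W Q R + ((ρ * R : ℝ) : EReal) := by
  refine EReal.sub_le_iff_le_add (.inl (EReal.coe_ne_bot _)) (.inl (EReal.coe_ne_top _)) |>.1 ?_
  refine le_EexWeak fun P hP hR => ?_
  refine EReal.sub_le_iff_le_add (.inl (EReal.coe_ne_bot _)) (.inl (EReal.coe_ne_top _)) |>.2 ?_
  refine (ExWeak_le hQ hP (by linarith)).trans ?_
  rw [← EReal.coe_add, EReal.coe_le_coe_iff]
  nlinarith

/-- Strong duality: if `E'_x(Q, ρ) - ρ R ≤ c` for all `ρ ≥ 1`, some admissible joint distribution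
has `𝔼[d_B] + I - R ≤ c`. -/
theorem exists_finiteJoint_of_ExWeak_le (hW : IsStochastic W) (hQ : Q ∈ stdSimplex ℝ X) {R c : ℝ}
    (h : ∀ ρ : ℝ, 1 ≤ ρ → ExWeak W Q ρ ≤ ((c + ρ * R : ℝ) : EReal)) :
    ∃ P ∈ finiteJoint W Q, mutualInfo P ≤ R ∧ meanDist W P + mutualInfo P - R ≤ c := by
  obtain ⟨P, hP, hg, hf⟩ := exists_le_of_lagrangian_lt (K := finiteJoint W Q)
    (f := fun P => meanDist W P + mutualInfo P + -R) (g := fun P => mutualInfo P + -R) (c := c)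
    isCompact_finiteJoint ((convexOn_meanDist.add convexOn_mutualInfo).add_const _)
    (convexOn_mutualInfo.add_const _)
    ((continuous_meanDist.continuousOn.add continuousOn_mutualInfo_finiteJoint).add
      continuousOn_const)
    (continuousOn_mutualInfo_finiteJoint.add continuousOn_const) (by
      intro s hs c' hc'
      obtain ⟨P, hP, hPe⟩ := exists_ExWeak_eq hW hQ (show 0 < 1 + s by linarith)
      have h1 := h (1 + s) (by linarith)
      rw [hPe, EReal.coe_le_coe_iff] at h1
      exact ⟨P, hP, by linarith⟩)
  exact ⟨P, hP, by linarith, by linarith⟩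

end Channel

/-! ### Primal and dual exponents -/

section Exponents

variable {V X Y : Type*} [Fintype V] [Fintype X] [Fintype Y] {PV : V → ℝ} {W : X → Y → ℝ}
  {t : ℝ} {m : ℕ} {Qs : Fin m → X → ℝ}

theorem srcRel_le {Q : V → ℝ} (hQ : Q ∈ acDist PV) {r : ℝ} (hr : r ≤ entropy Q) :
    srcRel PV r ≤ ((crossEntropy PV Q - entropy Q : ℝ) : EReal) :=
  (iInf₂_le Q hQ.1).trans ((iInf_le _ hr).trans (relEntropy_of_mem hQ).le)

theorem ExBar_le (hQs : ∀ c, Qs c ∈ stdSimplex ℝ X) (lam : ℝ) {R : ℝ} (hR : 0 ≤ R) :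
    ExBar W Qs lam ≤ (⨆ c, EexWeak W (Qs c) R) + ((lam * R : ℝ) : EReal) := by
  refine (iInf₂_le R hR).trans (iSup₂_le fun ρ hρ => ?_)
  have h : (⨆ c, ExWeak W (Qs c) ρ) ≤ (⨆ c, EexWeak W (Qs c) R) + ((ρ * R : ℝ) : EReal) :=
    iSup_le fun c => (ExWeak_le_EexWeak_add (hQs c) hρ R).trans
      (by gcongr; exact le_iSup (fun c => EexWeak W (Qs c) R) c)
  refine (add_le_add_left h _).trans (le_of_eq ?_)
  rw [add_assoc, ← EReal.coe_add]
  congr 2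
  ring

/-- Weak duality. -/
theorem dualExponent_le_primalObj (hPV : PV ∈ stdSimplex ℝ V) (ht : 0 < t)
    (hQs : ∀ c, Qs c ∈ stdSimplex ℝ X) {R : ℝ} (hR : 0 ≤ R) :
    dualExponent PV W t Qs ≤ primalObj PV W t Qs R := by
  refine iSup₂_le fun lam hlam => EReal.sub_le_of_le_add ?_
  refine (ExBar_le hQs lam hR).trans ?_
  have h := mul_le_mul_of_nonneg_left
    (mul_sub_Es_le_srcRel hPV (show 0 ≤ lam by linarith) (R / t))
    (show (0 : EReal) ≤ (t : EReal) by exact_mod_cast ht.le)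
  rw [← EReal.coe_mul] at h
  have h2 : lam * R = t * (lam * (R / t) - Es PV lam) + t * Es PV lam := by
    field_simp
    ring
  rw [primalObj, h2, EReal.coe_add, ← add_assoc, add_comm (⨆ c, EexWeak W (Qs c) R)]
  gcongr

theorem dualExponent_ne_bot (hW : IsStochastic W) (hm : 0 < m)
    (hQs : ∀ c, Qs c ∈ stdSimplex ℝ X) : dualExponent PV W t Qs ≠ ⊥ := by
  obtain ⟨P, -, hP⟩ := exists_ExWeak_eq hW (hQs ⟨0, hm⟩) one_pos
  have h1 : ExWeak W (Qs ⟨0, hm⟩) 1 ≤ ExBar W Qs 1 := by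
    refine le_iInf₂ fun R _ => ?_
    refine le_trans ?_ (le_iSup₂ (f := fun (ρ : ℝ) (_ : 1 ≤ ρ) =>
      (⨆ c, ExWeak W (Qs c) ρ) + (((1 - ρ) * R : ℝ) : EReal)) 1 le_rfl)
    simpa using le_iSup (fun c => ExWeak W (Qs c) 1) ⟨0, hm⟩
  have h2 : ExBar W Qs 1 - ((t * Es PV 1 : ℝ) : EReal) ≤ dualExponent PV W t Qs :=
    le_iSup₂ (f := fun (lam : ℝ) (_ : 1 ≤ lam) =>
      ExBar W Qs lam - ((t * Es PV lam : ℝ) : EReal)) 1 le_rfl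
  have h3 := (EReal.sub_le_sub h1 le_rfl).trans h2
  rw [hP, ← EReal.coe_sub] at h3
  exact ((EReal.bot_lt_coe _).trans_le h3).ne'

/-- Strong duality for the inner exponent: a bound on `Ē'_x(𝒬ₘ, λ)` is witnessed by a rate and
joint distributions. -/
theorem exists_of_ExBar_lt (hW : IsStochastic W) (hQs : ∀ c, Qs c ∈ stdSimplex ℝ X) {lam e : ℝ}
    (h : ExBar W Qs lam < (e : EReal)) :
    ∃ R : ℝ, 0 ≤ R ∧ ∃ P : Fin m → X × X → ℝ, ∀ c, P c ∈ finiteJoint W (Qs c) ∧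
      mutualInfo (P c) ≤ R ∧ meanDist W (P c) + mutualInfo (P c) + (lam - 1) * R ≤ e := by
  obtain ⟨R, hR⟩ := iInf_lt_iff.1 h
  obtain ⟨hR0, hR⟩ := iInf_lt_iff.1 hR
  refine ⟨R, hR0, ?_⟩
  have key : ∀ c, ∃ P ∈ finiteJoint W (Qs c), mutualInfo P ≤ R ∧
      meanDist W P + mutualInfo P - R ≤ e - lam * R := by
    refine fun c => exists_finiteJoint_of_ExWeak_le hW (hQs c) fun ρ hρ => ?_
    have h1 := (le_iSup₂ (f := fun (ρ : ℝ) (_ : 1 ≤ ρ) =>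
      (⨆ c, ExWeak W (Qs c) ρ) + (((lam - ρ) * R : ℝ) : EReal)) ρ hρ).trans hR.le
    have h2 := (le_iSup (fun c => ExWeak W (Qs c) ρ) c).trans
      ((EReal.le_sub_iff_add_le (.inl (EReal.coe_ne_bot _)) (.inl (EReal.coe_ne_top _))).2 h1)
    rw [← EReal.coe_sub] at h2
    refine h2.trans (EReal.coe_le_coe_iff.2 (le_of_eq ?_))
    ring
  choose P hP hI hle using key
  exact ⟨P, fun c => ⟨hP c, hI c, by linarith [hle c]⟩⟩

/-- A rate in `[0, M]`, a source distribution, and one joint distribution per input distribution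
with mutual information at most the rate. -/
def feasible (PV : V → ℝ) (W : X → Y → ℝ) (Qs : Fin m → X → ℝ) (M : ℝ) :
    Set (ℝ × (V → ℝ) × (Fin m → X × X → ℝ)) :=
  {z | z.1 ∈ Set.Icc 0 M ∧ z.2.1 ∈ acDist PV ∧
    ∀ c, z.2.2 c ∈ finiteJoint W (Qs c) ∧ mutualInfo (z.2.2 c) ≤ z.1}

theorem convex_feasible (M : ℝ) : Convex ℝ (feasible PV W Qs M) := by
  refine fun z hz w hw a b ha hb hab => ⟨convex_Icc 0 M hz.1 hw.1 ha hb hab,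
    convex_acDist hz.2.1 hw.2.1 ha hb hab, fun c =>
      ⟨convex_finiteJoint (hz.2.2 c).1 (hw.2.2 c).1 ha hb hab, ?_⟩⟩
  refine (convexOn_mutualInfo.2 (hz.2.2 c).1 (hw.2.2 c).1 ha hb hab).trans ?_
  exact add_le_add (mul_le_mul_of_nonneg_left (hz.2.2 c).2 ha)
    (mul_le_mul_of_nonneg_left (hw.2.2 c).2 hb)

theorem isCompact_feasible (M : ℝ) : IsCompact (feasible PV W Qs M) := by
  have hbox : IsCompact (Set.Icc (0 : ℝ) M ×ˢ acDist PV ×ˢ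
      Set.univ.pi fun c => finiteJoint W (Qs c)) :=
    isCompact_Icc.prod (isCompact_acDist.prod (isCompact_univ_pi fun _ => isCompact_finiteJoint))
  have hset : feasible PV W Qs M = (Set.Icc (0 : ℝ) M ×ˢ acDist PV ×ˢ
      Set.univ.pi fun c => finiteJoint W (Qs c)) ∩ ⋂ c, {z | entropy (fun x => ∑ x',
        z.2.2 c (x, x')) + entropy (sndMarginal (z.2.2 c)) - entropy (z.2.2 c) ≤ z.1} := by
    ext z
    simp only [feasible, Set.mem_ofPred_eq, Set.mem_inter_iff, Set.mem_prod, Set.mem_univ_pi,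
      Set.mem_iInter]
    constructor
    · exact fun h => ⟨⟨h.1, h.2.1, fun c => (h.2.2 c).1⟩, fun c =>
        mutualInfo_eq_entropy (h.2.2 c).1.1.1 ▸ (h.2.2 c).2⟩
    · exact fun h => ⟨h.1.1, h.1.2.1, fun c => ⟨h.1.2.2 c,
        (mutualInfo_eq_entropy (h.1.2.2 c).1.1).trans_le (h.2 c)⟩⟩
  rw [hset]
  refine hbox.inter_right (isClosed_iInter fun c => isClosed_le ?_ continuous_fst)
  unfold sndMarginal
  refine ((continuous_entropy.comp ?_).add (continuous_entropy.comp ?_)).sub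
    (continuous_entropy.comp ?_)
  all_goals fun_prop

/-- Strong duality: the dual exponent bounds the primal objective at some rate. -/
theorem exists_primalObj_le (hPV : PV ∈ stdSimplex ℝ V) (hW : IsStochastic W) (ht : 0 < t)
    (hm : 0 < m) (hQs : ∀ c, Qs c ∈ stdSimplex ℝ X) {d : ℝ}
    (hd : dualExponent PV W t Qs ≤ (d : EReal)) :
    ∃ R : ℝ, 0 ≤ R ∧ primalObj PV W t Qs R ≤ (d : EReal) := by
  have hne : (Finset.univ : Finset (Fin m)).Nonempty := ⟨⟨0, hm⟩, Finset.mem_univ _⟩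
  obtain ⟨M, hM⟩ := (isCompact_stdSimplex ℝ (X × X)).exists_bound_of_continuousOn
    continuousOn_mutualInfo
  have hM' : ∀ P ∈ stdSimplex ℝ (X × X), mutualInfo P ≤ max 0 M := fun P hP =>
    (le_abs_self _).trans ((hM P hP).trans (le_max_right _ _))
  set K := feasible PV W Qs (max 0 M) with hKdef
  set cost : (X × X → ℝ) → ℝ := fun P => meanDist W P + mutualInfo P with hcost
  have hcostK : ∀ c, ConvexOn ℝ (finiteJoint W (Qs c)) cost := fun c =>
    convexOn_meanDist.add convexOn_mutualInfo
  obtain ⟨z, hz, hg, hf⟩ := exists_le_of_lagrangian_lt (K := K)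
    (f := fun z => t * (crossEntropy PV z.2.1 - 2 * entropy z.2.1) +
      Finset.univ.sup' hne fun c => cost (z.2.2 c))
    (g := fun z => z.1 - t * entropy z.2.1) (c := d)
    (isCompact_feasible _) (by
      refine ⟨convex_feasible _, fun z hz w hw a b ha hb hab => ?_⟩
      have h1 := concaveOn_entropy.2 hz.2.1.1 hw.2.1.1 ha hb hab
      have h2 : (Finset.univ.sup' hne fun c => cost ((a • z + b • w).2.2 c)) ≤
          a * (Finset.univ.sup' hne fun c => cost (z.2.2 c)) +
            b * (Finset.univ.sup' hne fun c => cost (w.2.2 c)) := by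
        refine Finset.sup'_le _ _ fun c hc => ?_
        refine ((hcostK c).2 (hz.2.2 c).1 (hw.2.2 c).1 ha hb hab).trans ?_
        exact add_le_add
          (mul_le_mul_of_nonneg_left (Finset.le_sup' (fun c => cost (z.2.2 c)) hc) ha)
          (mul_le_mul_of_nonneg_left (Finset.le_sup' (fun c => cost (w.2.2 c)) hc) hb)
      have h3 := crossEntropy_combo (PV := PV) z.2.1 w.2.1 a b
      have h4 : (a • z + b • w).2.1 = a • z.2.1 + b • w.2.1 := rfl
      simp only [smul_eq_mul] at h1 ⊢
      rw [h4, h3]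
      nlinarith [mul_le_mul_of_nonneg_left h1 ht.le]) (by
      refine ⟨convex_feasible _, fun z hz w hw a b ha hb hab => ?_⟩
      have h1 := concaveOn_entropy.2 hz.2.1.1 hw.2.1.1 ha hb hab
      have h4 : (a • z + b • w).2.1 = a • z.2.1 + b • w.2.1 := rfl
      have h5 : (a • z + b • w).1 = a * z.1 + b * w.1 := rfl
      simp only [smul_eq_mul] at h1 ⊢
      rw [h4, h5]
      nlinarith [mul_le_mul_of_nonneg_left h1 ht.le]) (by
      have hent : Continuous fun z : ℝ × (V → ℝ) × (Fin m → X × X → ℝ) => entropy z.2.1 :=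
        continuous_entropy.comp (by fun_prop)
      have hcr : Continuous fun z : ℝ × (V → ℝ) × (Fin m → X × X → ℝ) => crossEntropy PV z.2.1 :=
        continuous_crossEntropy.comp (by fun_prop)
      refine ((hcr.sub (hent.const_mul 2)).const_mul t).continuousOn.add
        (ContinuousOn.finset_sup'_apply hne fun c _ => ?_)
      have hproj : Continuous fun z : ℝ × (V → ℝ) × (Fin m → X × X → ℝ) => z.2.2 c := by fun_prop
      exact (continuous_meanDist.comp hproj).continuousOn.add
        (continuousOn_mutualInfo.comp hproj.continuousOn fun z hz => (hz.2.2 c).1.1)) (by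
      have hent : Continuous fun z : ℝ × (V → ℝ) × (Fin m → X × X → ℝ) => entropy z.2.1 :=
        continuous_entropy.comp (by fun_prop)
      exact (continuous_fst.sub (hent.const_mul t)).continuousOn) (by
      intro s hs c' hc'
      have h1 : ExBar W Qs (1 + s) - ((t * Es PV (1 + s) : ℝ) : EReal) ≤ (d : EReal) :=
        (le_iSup₂ (f := fun (lam : ℝ) (_ : 1 ≤ lam) =>
          ExBar W Qs lam - ((t * Es PV lam : ℝ) : EReal)) (1 + s) (by linarith)).trans hd
      rw [EReal.sub_le_iff_le_add (.inl (EReal.coe_ne_bot _)) (.inl (EReal.coe_ne_top _)),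
        ← EReal.coe_add] at h1
      obtain ⟨R, hR, P, hP⟩ := exists_of_ExBar_lt hW hQs
        (h1.trans_lt (EReal.coe_lt_coe_iff.2 (add_lt_add_left
          (show d < (d + c') / 2 by linarith) (t * Es PV (1 + s)))))
      obtain ⟨Q, hQ, hQe⟩ := exists_eq_neg_Es hPV (show 0 ≤ 1 + s by linarith)
      refine ⟨(min R (max 0 M), Q, P), ⟨⟨le_min hR (le_max_left _ _), min_le_right _ _⟩, hQ,
        fun c => ⟨(hP c).1, le_min (hP c).2.1 (hM' _ (hP c).1.1)⟩⟩, ?_⟩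
      have h2 : (Finset.univ.sup' hne fun c => cost (P c)) ≤
          (d + c') / 2 + t * Es PV (1 + s) - s * R :=
        Finset.sup'_le _ _ fun c _ => by
          have := (hP c).2.2
          simp only [hcost]
          linarith
      have h3 := mul_le_mul_of_nonneg_left (min_le_left R (max 0 M)) hs
      have h4 : t * (crossEntropy PV Q - (1 + (1 + s)) * entropy Q) = t * -Es PV (1 + s) := by
        rw [hQe]
      dsimp only
      linarith)
  have hR0 : 0 ≤ t * entropy z.2.1 := mul_nonneg ht.le (entropy_nonneg hz.2.1.1)
  refine ⟨t * entropy z.2.1, hR0, ?_⟩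
  have h1 : (t : EReal) * srcRel PV (t * entropy z.2.1 / t) ≤
      ((t * (crossEntropy PV z.2.1 - entropy z.2.1) : ℝ) : EReal) := by
    rw [EReal.coe_mul]
    exact mul_le_mul_of_nonneg_left (srcRel_le hz.2.1 (by rw [mul_div_cancel_left₀ _ ht.ne']))
      (by exact_mod_cast ht.le)
  have h2 : (⨆ c, EexWeak W (Qs c) (t * entropy z.2.1)) ≤
      (((Finset.univ.sup' hne fun c => cost (z.2.2 c)) - t * entropy z.2.1 : ℝ) : EReal) := by
    refine iSup_le fun c => (EexWeak_le (hz.2.2 c).1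
      ((hz.2.2 c).2.trans (by linarith))).trans (EReal.coe_le_coe_iff.2 ?_)
    have := Finset.le_sup' (fun c => cost (z.2.2 c)) (Finset.mem_univ c)
    simp only [hcost] at this ⊢
    linarith
  refine (add_le_add h1 h2).trans ?_
  rw [← EReal.coe_add, EReal.coe_le_coe_iff]
  linarith

end Exponents

/-- The primal and dual exponents coincide: the minimum over `R ≥ 0` of the primal objective is
attained, and it equals the dual exponent. -/
theorem stmt6 {V X Y : Type*} [Fintype V] [Fintype X] [Fintype Y]
    (PV : V → ℝ) (hPV : PV ∈ stdSimplex ℝ V) (W : X → Y → ℝ) (hW : IsStochastic W)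
    (t : ℝ) (ht : 0 < t) (m : ℕ) (hm : 0 < m)
    (Qs : Fin m → X → ℝ) (hQs : ∀ c, Qs c ∈ stdSimplex ℝ X) :
    (⨅ (R : ℝ) (_ : 0 ≤ R), primalObj PV W t Qs R) = dualExponent PV W t Qs ∧
      ∃ R : ℝ, 0 ≤ R ∧ primalObj PV W t Qs R = dualExponent PV W t Qs := by
  have hweak : ∀ R : ℝ, 0 ≤ R → dualExponent PV W t Qs ≤ primalObj PV W t Qs R :=
    fun R hR => dualExponent_le_primalObj hPV ht hQs hR
  have hattain : ∃ R : ℝ, 0 ≤ R ∧ primalObj PV W t Qs R = dualExponent PV W t Qs := by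
    by_cases htop : dualExponent PV W t Qs = ⊤
    · exact ⟨0, le_rfl, le_antisymm (htop ▸ le_top) (hweak 0 le_rfl)⟩
    · have hcoe := EReal.coe_toReal htop (dualExponent_ne_bot (PV := PV) (t := t) hW hm hQs)
      obtain ⟨R, hR, hle⟩ := exists_primalObj_le hPV hW ht hm hQs hcoe.ge
      exact ⟨R, hR, le_antisymm (hle.trans hcoe.le) (hweak R hR)⟩
  refine ⟨le_antisymm ?_ (le_iInf₂ hweak), hattain⟩
  obtain ⟨R, hR, hRe⟩ := hattain
  exact (iInf₂_le R hR).trans hRe.le
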